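/- For k ≥ 1 and n ≥ 2, the number of permutations of length n that avoid the classical pattern 1-2-3, begin with the pattern k(k-1)⋯1, and end with the pattern 12, equals N_k(n-1) + (k-1)·δ_{n,k+1}, where N_k(m) denotes the number of permutations of length m that avoid 1-2-3 and begin with the pattern k(k-1)⋯1, and δ is the Kronecker delta. -/

import Mathlib

/-- `π` avoids the classical pattern 1-2-3: there are no indices `i < j < k`
with `π i < π j < π k`. -/
def AvoidsC123 {n : ℕ} (π : Equiv.Perm (Fin n)) : Prop :=
  ¬ ∃ i j k : Fin n, i < j ∧ j < k ∧ π i < π j ∧ π j < π k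

/-- `π` begins with the pattern `k(k-1)⋯1`: its first `k` letters are decreasing
(in particular the length is at least `k`). -/
def BeginsDec {n : ℕ} (π : Equiv.Perm (Fin n)) (k : ℕ) : Prop :=
  k ≤ n ∧ ∀ i j : Fin n, i < j → (j : ℕ) < k → π j < π i

/-- `π` ends with the pattern `12`: it has length at least 2 and
`π (n-1) < π n`. -/
def EndsInc12 {n : ℕ} (π : Equiv.Perm (Fin n)) : Prop :=
  ∃ h : 1 < n, π ⟨n - 2, by omega⟩ < π ⟨n - 1, by omega⟩

/-- `N k m` is the number of permutations of length `m` avoiding the classical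
pattern 1-2-3 and beginning with the pattern `k(k-1)⋯1`. -/
noncomputable def N (k m : ℕ) : ℕ :=
  Nat.card {π : Equiv.Perm (Fin m) // AvoidsC123 π ∧ BeginsDec π k}

/-- Insert the value `v` at position `p` into `σ`. -/
def insP {n : ℕ} (p v : Fin (n+1)) (σ : Equiv.Perm (Fin n)) : Equiv.Perm (Fin (n+1)) :=
  ((finSuccEquiv' p).trans (Equiv.optionCongr σ)).trans (finSuccEquiv' v).symm

theorem insP_at {n : ℕ} (p v : Fin (n+1)) (σ : Equiv.Perm (Fin n)) : insP p v σ p = v := by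
  simp [insP]

theorem insP_above {n : ℕ} (p v : Fin (n+1)) (σ : Equiv.Perm (Fin n)) (i : Fin n) :
    insP p v σ (p.succAbove i) = v.succAbove (σ i) := by
  simp [insP]

theorem insP_inj {n : ℕ} (p v : Fin (n+1)) (σ τ : Equiv.Perm (Fin n))
    (h : insP p v σ = insP p v τ) : σ = τ := by
  ext i
  have := congrArg (fun f => f (p.succAbove i)) h
  simp only [insP_above] at this
  rw [Fin.succAbove_right_injective this]

theorem insP_surj {n : ℕ} (p v : Fin (n+1)) (π : Equiv.Perm (Fin (n+1))) (h : π p = v) :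
    ∃ σ, insP p v σ = π := by
  have hne : ∀ i, ∃ j, v.succAbove j = π (p.succAbove i) := by
    intro i
    apply Fin.exists_succAbove_eq
    rw [← h]
    intro h2
    exact Fin.succAbove_ne p i (π.injective h2)
  choose f hf using hne
  have hinj : Function.Injective f := by
    intro a b hab
    have : π (p.succAbove a) = π (p.succAbove b) := by rw [← hf, ← hf, hab]
    exact Fin.succAbove_right_injective (π.injective this)
  refine ⟨Equiv.ofBijective f (Finite.injective_iff_bijective.mp hinj), ?_⟩
  apply Equiv.ext
  intro x
  rcases eq_or_ne x p with rfl | hx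
  · rw [insP_at, h]
  · obtain ⟨i, rfl⟩ := Fin.exists_succAbove_eq hx
    rw [insP_above]
    simp [hf]

/-- penultimate position -/
def penP (m : ℕ) : Fin (m+2) := ⟨m, by omega⟩

theorem pen_zero {m : ℕ} (π : Equiv.Perm (Fin (m+2))) (ha : AvoidsC123 π) (he : EndsInc12 π) :
    π (penP m) = 0 := by
  obtain ⟨_, he⟩ := he
  have he' : π (penP m) < π (Fin.last (m+1)) := he
  obtain ⟨x, hx⟩ := π.surjective 0
  by_contra hne
  have hpos : π x < π (penP m) := by rw [hx]; exact Fin.pos_of_ne_zero hne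
  have h1 : x ≠ penP m := by rintro rfl; exact hne hx
  have h2 : x ≠ Fin.last (m+1) := by
    rintro rfl
    exact lt_asymm he' hpos
  apply ha
  refine ⟨x, penP m, Fin.last (m+1), ?_, ?_, hpos, he'⟩
  · have := x.2
    simp only [ne_eq, Fin.ext_iff, penP, Fin.val_last, Fin.lt_def] at *
    omega
  · simp [penP, Fin.lt_def]

theorem insP_avoid {m : ℕ} (σ : Equiv.Perm (Fin (m+1))) :
    AvoidsC123 (insP (penP m) 0 σ) ↔ AvoidsC123 σ := by
  unfold AvoidsC123
  rw [not_iff_not]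
  constructor
  · rintro ⟨i, j, l, hij, hjl, h1, h2⟩
    have hi : i ≠ penP m := by
      rintro rfl
      have := l.2
      simp only [penP, Fin.lt_def] at hij hjl
      omega
    have hj : j ≠ penP m := by
      rintro rfl
      rw [insP_at] at h1
      exact absurd h1 (Fin.not_lt_zero _)
    have hl : l ≠ penP m := by
      rintro rfl
      rw [insP_at] at h2
      exact absurd h2 (Fin.not_lt_zero _)
    obtain ⟨i, rfl⟩ := Fin.exists_succAbove_eq hi
    obtain ⟨j, rfl⟩ := Fin.exists_succAbove_eq hj
    obtain ⟨l, rfl⟩ := Fin.exists_succAbove_eq hl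
    simp only [insP_above, Fin.succAbove_lt_succAbove_iff] at *
    exact ⟨i, j, l, hij, hjl, h1, h2⟩
  · rintro ⟨i, j, l, hij, hjl, h1, h2⟩
    refine ⟨(penP m).succAbove i, (penP m).succAbove j, (penP m).succAbove l, ?_⟩
    simp only [insP_above, Fin.succAbove_lt_succAbove_iff]
    exact ⟨hij, hjl, h1, h2⟩

theorem insP_ends {m : ℕ} (σ : Equiv.Perm (Fin (m+1))) : EndsInc12 (insP (penP m) 0 σ) := by
  refine ⟨by omega, ?_⟩
  change insP (penP m) 0 σ (penP m) < insP (penP m) 0 σ (Fin.last (m+1))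
  have : (insP (penP m) 0 σ) (Fin.last (m+1)) ≠ insP (penP m) 0 σ (penP m) := by
    intro h
    have := (insP (penP m) 0 σ).injective h
    simp [penP, Fin.ext_iff] at this
  rw [insP_at] at *
  exact Fin.pos_of_ne_zero this

theorem pen_above_val {m : ℕ} (i : Fin (m+1)) (h : (i : ℕ) < m) :
    (((penP m).succAbove i : Fin (m+2)) : ℕ) = i := by
  rw [Fin.succAbove_of_castSucc_lt]
  · simp
  · simpa [penP, Fin.lt_def] using h

theorem insP_begins {m k : ℕ} (hk : k ≤ m) (σ : Equiv.Perm (Fin (m+1))) :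
    BeginsDec (insP (penP m) 0 σ) k ↔ BeginsDec σ k := by
  constructor
  · rintro ⟨_, h⟩
    refine ⟨by omega, fun i j hij hj => ?_⟩
    have := h ((penP m).succAbove i) ((penP m).succAbove j)
      (by simpa using hij) (by rw [pen_above_val j (by omega)]; exact hj)
    simpa only [insP_above, Fin.succAbove_lt_succAbove_iff] using this
  · rintro ⟨_, h⟩
    refine ⟨by omega, fun i j hij hj => ?_⟩
    have hi' : i ≠ penP m := by
      rintro rfl
      simp only [penP, Fin.lt_def] at hij
      omega
    have hj' : j ≠ penP m := by
      rintro rfl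
      simp only [penP] at hj
      omega
    obtain ⟨i, rfl⟩ := Fin.exists_succAbove_eq hi'
    obtain ⟨j, rfl⟩ := Fin.exists_succAbove_eq hj'
    simp only [insP_above, Fin.succAbove_lt_succAbove_iff] at *
    refine h i j hij ?_
    by_cases hjm : (j : ℕ) < m
    · rwa [pen_above_val j hjm] at hj
    · rw [Fin.succAbove_of_le_castSucc] at hj
      · simp at hj; omega
      · simp [penP, Fin.le_def]; omega

theorem anti_eq_rev {m : ℕ} (σ : Equiv.Perm (Fin m)) (h : ∀ i j, i < j → σ j < σ i) :
    σ = Fin.revPerm := by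
  have h1 : StrictMono (fun i => σ (Fin.rev i)) := fun i j hij => h _ _ (Fin.rev_lt_rev.mpr hij)
  have h2 : (fun i => σ (Fin.rev i)) = id := by
    apply (StrictMono.range_inj h1 strictMono_id).1
    rw [Set.range_id]
    exact (σ.surjective.comp Fin.rev_surjective).range_eq
  ext i
  have := congrFun h2 (Fin.rev i)
  simp at this
  simp [this]

theorem N_self (k : ℕ) : N k k = 1 := by
  unfold N
  rw [Nat.card_eq_one_iff_unique]
  refine ⟨⟨?_⟩, ⟨⟨Fin.revPerm, ?_, le_rfl, ?_⟩⟩⟩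
  · rintro ⟨a, _, _, ha⟩ ⟨b, _, _, hb⟩
    apply Subtype.ext
    simp only
    rw [anti_eq_rev a (fun i j h => ha i j h j.2), anti_eq_rev b (fun i j h => hb i j h j.2)]
  · rintro ⟨i, j, l, hij, hjl, h1, h2⟩
    simp at h1
    exact lt_asymm hij h1
  · intro i j hij _
    simpa using hij

theorem case_diag (m : ℕ) :
    Nat.card {π : Equiv.Perm (Fin (m+2)) // AvoidsC123 π ∧ BeginsDec π (m+1) ∧ EndsInc12 π}
      = m + 1 := by
  have key : ∀ σ : Equiv.Perm (Fin (m+1)),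
      (AvoidsC123 (insP (penP m) 0 σ) ∧ BeginsDec (insP (penP m) 0 σ) (m+1)) ↔
        ∃ v, σ = insP (Fin.last m) v Fin.revPerm := by
    intro σ
    rw [insP_avoid]
    constructor
    · rintro ⟨_, _, h⟩
      refine ⟨σ (Fin.last m), ?_⟩
      obtain ⟨τ, hτ⟩ := insP_surj (Fin.last m) _ σ rfl
      rw [← anti_eq_rev τ, hτ]
      intro i j hij
      have := h ((penP m).succAbove i.castSucc) ((penP m).succAbove j.castSucc)
        (by simpa using hij)
        (by rw [pen_above_val _ (by simp)]; simp)
      rw [insP_above, insP_above, Fin.succAbove_lt_succAbove_iff, ← hτ,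
        ← Fin.succAbove_last_apply, ← Fin.succAbove_last_apply, insP_above, insP_above,
        Fin.succAbove_lt_succAbove_iff] at this
      exact this
    · rintro ⟨v, rfl⟩
      have hd : ∀ i j : Fin (m+1), i < j → (j : ℕ) < m →
          insP (Fin.last m) v Fin.revPerm j < insP (Fin.last m) v Fin.revPerm i := by
        intro i j hij hj
        obtain ⟨i, rfl⟩ : ∃ i', (Fin.last m).succAbove i' = i := Fin.exists_succAbove_eq (by
          rintro rfl; simp [Fin.lt_def] at hij; omega)
        obtain ⟨j, rfl⟩ : ∃ i', (Fin.last m).succAbove i' = j := Fin.exists_succAbove_eq (by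
          rintro rfl; simp at hj)
        rw [insP_above, insP_above, Fin.succAbove_lt_succAbove_iff]
        simpa using hij
      constructor
      · rintro ⟨i, j, l, hij, hjl, h1, h2⟩
        refine lt_asymm h1 (hd i j hij ?_)
        have := l.2
        simp only [Fin.lt_def] at hjl
        omega
      · refine ⟨by omega, fun i j hij hj => ?_⟩
        have hi' : i ≠ penP m := by
          rintro rfl
          simp only [penP, Fin.lt_def] at hij
          omega
        obtain ⟨i, rfl⟩ := Fin.exists_succAbove_eq hi'
        rcases eq_or_ne j (penP m) with rfl | hj'
        · rw [insP_at, insP_above]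
          simp
        · obtain ⟨j, rfl⟩ := Fin.exists_succAbove_eq hj'
          simp only [insP_above, Fin.succAbove_lt_succAbove_iff] at *
          refine hd i j hij ?_
          by_contra hjm
          rw [Fin.succAbove_of_le_castSucc] at hj
          · simp at hj; omega
          · simp [penP, Fin.le_def]; omega
  have hb : Function.Bijective (fun v : Fin (m+1) =>
      (⟨insP (penP m) 0 (insP (Fin.last m) v Fin.revPerm),
        ((key _).2 ⟨v, rfl⟩).1, ((key _).2 ⟨v, rfl⟩).2, insP_ends _⟩ :
        {π : Equiv.Perm (Fin (m+2)) // AvoidsC123 π ∧ BeginsDec π (m+1) ∧ EndsInc12 π})) := by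
    constructor
    · intro v w h
      have h1 := insP_inj _ _ _ _ (congrArg Subtype.val h)
      have h2 := congrArg (fun f => f (Fin.last m)) h1
      simpa only [insP_at] using h2
    · rintro ⟨π, ha, hb, he⟩
      obtain ⟨σ, rfl⟩ := insP_surj _ _ π (pen_zero π ha he)
      obtain ⟨v, rfl⟩ := (key σ).1 ⟨ha, hb⟩
      exact ⟨v, rfl⟩
  rw [← Nat.card_eq_of_bijective _ hb]
  simp

theorem case_big (m k : ℕ) (hk : k ≤ m) :
    Nat.card {π : Equiv.Perm (Fin (m+2)) // AvoidsC123 π ∧ BeginsDec π k ∧ EndsInc12 π}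
      = N k (m + 1) := by
  have hb : Function.Bijective (fun s : {σ : Equiv.Perm (Fin (m+1)) // AvoidsC123 σ ∧ BeginsDec σ k} =>
      (⟨insP (penP m) 0 s.1, (insP_avoid _).2 s.2.1, (insP_begins hk _).2 s.2.2, insP_ends _⟩ :
        {π : Equiv.Perm (Fin (m+2)) // AvoidsC123 π ∧ BeginsDec π k ∧ EndsInc12 π})) := by
    constructor
    · intro v w h
      exact Subtype.ext (insP_inj _ _ _ _ (congrArg Subtype.val h))
    · rintro ⟨π, ha, hb, he⟩
      obtain ⟨σ, rfl⟩ := insP_surj _ _ π (pen_zero π ha he)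
      exact ⟨⟨σ, (insP_avoid _).1 ha, (insP_begins hk _).1 hb⟩, rfl⟩
  rw [N, ← Nat.card_eq_of_bijective _ hb]

theorem avoidC123_beginDec_end12_count (k n : ℕ) (hk : 1 ≤ k) (hn : 2 ≤ n) :
    Nat.card {π : Equiv.Perm (Fin n) // AvoidsC123 π ∧ BeginsDec π k ∧ EndsInc12 π}
      = N k (n - 1) + (k - 1) * (if n = k + 1 then 1 else 0) := by
  obtain ⟨m, rfl⟩ : ∃ m, n = m + 2 := ⟨n - 2, by omega⟩
  change _ = N k (m + 1) + _
  rcases lt_trichotomy k (m + 1) with h | h | h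
  · rw [case_big m k (by omega), if_neg (by omega)]
    simp
  · subst h
    rw [case_diag, N_self]
    simp
    omega
  · rw [if_neg (by omega)]
    have h1 : N k (m + 1) = 0 := by
      unfold N
      have : IsEmpty {π : Equiv.Perm (Fin (m+1)) // AvoidsC123 π ∧ BeginsDec π k} :=
        ⟨fun ⟨_, _, h2, _⟩ => by omega⟩
      exact Nat.card_of_isEmpty
    have : IsEmpty {π : Equiv.Perm (Fin (m+2)) // AvoidsC123 π ∧ BeginsDec π k ∧ EndsInc12 π} := by
      refine ⟨fun ⟨π, _, ⟨_, h2⟩, ⟨_, h3⟩⟩ => lt_asymm h3 (h2 _ _ ?_ ?_)⟩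
      · simp [Fin.lt_def]
      · simp; omega
    rw [h1, Nat.card_of_isEmpty]
    simp
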